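/- For every real number c with 0 < c < π² there exists a closed disk D of positive radius contained in the open positive quadrant (0,∞)² such that ∫_D 1/(x·y) dx dy = c (Lebesgue integral on ℝ²). -/

import Mathlib

open Real MeasureTheory

/-- An everywhere defined primitive of `1 / (1 + ρ cos θ)`, where `w = √(1 - ρ²)`. -/
lemma hasDerivAt_primitive_inv_one_add_mul_cos {ρ w : ℝ} (hρ : 0 ≤ ρ) (hw : 0 < w)
    (h : w ^ 2 = 1 - ρ ^ 2) (θ : ℝ) :
    HasDerivAt (fun θ => (θ - 2 * arctan (ρ * sin θ / (1 + w + ρ * cos θ))) / w)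
      (1 / (1 + ρ * cos θ)) θ := by
  have hρ1 : ρ < 1 := by nlinarith
  have hu : 0 < 1 + ρ * cos θ := by nlinarith [neg_one_le_cos θ]
  have hd : 0 < 1 + w + ρ * cos θ := by linarith
  have h1 := ((((hasDerivAt_sin θ).const_mul ρ).div
    (((hasDerivAt_cos θ).const_mul ρ).const_add (1 + w)) hd.ne').arctan.const_mul 2)
  refine (((hasDerivAt_id θ).sub h1).div_const w).congr_deriv ?_
  have hsc := sin_sq_add_cos_sq θ
  have key : (1 + w + ρ * cos θ) ^ 2 + (ρ * sin θ) ^ 2 = 2 * (1 + w) * (1 + ρ * cos θ) := by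
    linear_combination h + ρ ^ 2 * hsc
  have hsq : 1 + (ρ * sin θ / (1 + w + ρ * cos θ)) ^ 2
      = 2 * (1 + w) * (1 + ρ * cos θ) / (1 + w + ρ * cos θ) ^ 2 := by
    rw [← key]; field_simp
  rw [Pi.div_apply, hsq]
  have hw1 : 0 < 1 + w := by linarith
  field_simp
  linear_combination -h - ρ ^ 2 * hsc

lemma integral_inv_one_add_mul_cos_mul_one_add_mul_sin {ρ : ℝ} (hρ : 0 ≤ ρ) (hρ1 : ρ < 1) :
    ∫ θ in (-π)..π, 1 / ((1 + ρ * cos θ) * (1 + ρ * sin θ))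
      = 4 * π / ((2 - ρ ^ 2) * √(1 - ρ ^ 2)) := by
  have hpos : 0 < 1 - ρ ^ 2 := by nlinarith
  set w := √(1 - ρ ^ 2) with hwdef
  have hw : 0 < w := Real.sqrt_pos.2 hpos
  have h : w ^ 2 = 1 - ρ ^ 2 := Real.sq_sqrt hpos.le
  have hu (θ : ℝ) : 0 < 1 + ρ * cos θ := by nlinarith [neg_one_le_cos θ]
  have hv (θ : ℝ) : 0 < 1 + ρ * sin θ := by nlinarith [neg_one_le_sin θ]
  have h2 : 0 < 2 - ρ ^ 2 := by linarith
  let F : ℝ → ℝ := fun θ => (θ - 2 * arctan (ρ * sin θ / (1 + w + ρ * cos θ))) / w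
  have hF := hasDerivAt_primitive_inv_one_add_mul_cos hρ hw h
  have hderiv (θ : ℝ) : HasDerivAt
      (fun θ => (F θ + log (1 + ρ * cos θ) + (F (θ - π / 2) - log (1 + ρ * sin θ)))
        / (2 - ρ ^ 2))
      (1 / ((1 + ρ * cos θ) * (1 + ρ * sin θ))) θ := by
    have hlc := (((hasDerivAt_cos θ).const_mul ρ).const_add 1).log (hu θ).ne'
    have hls := (((hasDerivAt_sin θ).const_mul ρ).const_add 1).log (hv θ).ne'
    have hF2 := (hF (θ - π / 2)).comp_sub_const θ (π / 2)
    rw [cos_sub_pi_div_two] at hF2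
    refine ((((hF θ).add hlc).add (hF2.sub hls)).div_const (2 - ρ ^ 2)).congr_deriv ?_
    have := (hu θ).ne'
    have := (hv θ).ne'
    field_simp
    linear_combination (-ρ ^ 2) * sin_sq_add_cos_sq θ
  rw [intervalIntegral.integral_eq_sub_of_hasDerivAt (fun θ _ => hderiv θ)]
  · have e : -π - π / 2 = (π - π / 2) - 2 * π := by ring
    simp only [F, e, sin_sub_two_pi, cos_sub_two_pi, sin_neg, cos_neg, sin_pi]
    field_simp
    simp
    ring
  · refine Continuous.intervalIntegrable ?_ _ _
    exact continuous_const.div (by fun_prop) fun θ => (mul_pos (hu θ) (hv θ)).ne'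

lemma integral_radial_log_area {R : ℝ} (hR : 0 ≤ R) (hR1 : R < 1) :
    ∫ ρ in (0)..R, ρ * (4 * π / ((2 - ρ ^ 2) * √(1 - ρ ^ 2)))
      = π ^ 2 - 4 * π * arctan (√(1 - R ^ 2)) := by
  have hpos : ∀ ρ ∈ Set.uIcc 0 R, 0 < 1 - ρ ^ 2 := by
    intro ρ hρ
    rw [Set.uIcc_of_le hR] at hρ
    nlinarith [hρ.1, hρ.2]
  rw [intervalIntegral.integral_eq_sub_of_hasDerivAt
    (f := fun ρ => -(4 * π * arctan (√(1 - ρ ^ 2))))]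
  · simp [arctan_one]; ring
  · intro ρ hρ
    have hp := hpos ρ hρ
    have hs := Real.sqrt_pos.2 hp
    have h1 := ((((hasDerivAt_pow 2 ρ).const_sub 1).sqrt hp.ne').arctan.const_mul (4 * π)).neg
    refine h1.congr_deriv ?_
    rw [Real.sq_sqrt hp.le]
    have : 0 < 2 - ρ ^ 2 := by linarith
    have e : 1 + (1 - ρ ^ 2) = 2 - ρ ^ 2 := by ring
    rw [e]
    field_simp
    norm_num
  · refine ContinuousOn.intervalIntegrable ?_
    refine continuousOn_id.mul (continuousOn_const.div (by fun_prop) fun ρ hρ => ?_)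
    have hp := hpos ρ hρ
    exact (mul_pos (by linarith) (Real.sqrt_pos.2 hp)).ne'

lemma integral_disk_eq_polar {R : ℝ} (hR : 0 ≤ R) (f : ℝ × ℝ → ℝ) :
    ∫ z in {z : ℝ × ℝ | z.1 ^ 2 + z.2 ^ 2 ≤ R ^ 2}, f z
      = ∫ p in Set.Ioc 0 R ×ˢ Set.Ioo (-π) π, p.1 * f (p.1 * cos p.2, p.1 * sin p.2) := by
  have hm : MeasurableSet {z : ℝ × ℝ | z.1 ^ 2 + z.2 ^ 2 ≤ R ^ 2} :=
    measurableSet_le (by fun_prop) (by fun_prop)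
  have hm' : MeasurableSet (Set.Ioc 0 R ×ˢ (Set.univ : Set ℝ)) :=
    measurableSet_Ioc.prod .univ
  rw [← integral_indicator hm, ← integral_comp_polarCoord_symm]
  have hset : Set.Ioc 0 R ×ˢ Set.Ioo (-π) π
      = polarCoord.target ∩ Set.Ioc 0 R ×ˢ (Set.univ : Set ℝ) := by
    ext p
    simp only [polarCoord_target, Set.mem_prod, Set.mem_inter_iff, Set.mem_Ioc, Set.mem_Ioi,
      Set.mem_univ, and_true]
    tauto
  rw [hset, ← setIntegral_indicator hm']
  refine setIntegral_congr_fun polarCoord.open_target.measurableSet fun p hp => ?_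
  have hp0 : 0 < p.1 := by
    simpa using hp.1
  have hiff : (p.1 * cos p.2) ^ 2 + (p.1 * sin p.2) ^ 2 ≤ R ^ 2 ↔ p.1 ≤ R := by
    rw [show (p.1 * cos p.2) ^ 2 + (p.1 * sin p.2) ^ 2 = p.1 ^ 2 by
      linear_combination p.1 ^ 2 * sin_sq_add_cos_sq p.2]
    exact pow_le_pow_iff_left₀ hp0.le hR two_ne_zero
  simp [Set.indicator, hiff, hp0]

lemma log_area_centered {R : ℝ} (hR : 0 ≤ R) (hR1 : R < 1) :
    ∫ z in {z : ℝ × ℝ | z.1 ^ 2 + z.2 ^ 2 ≤ R ^ 2}, 1 / ((1 + z.1) * (1 + z.2))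
      = π ^ 2 - 4 * π * arctan (√(1 - R ^ 2)) := by
  rw [integral_disk_eq_polar hR, Measure.volume_eq_prod, setIntegral_prod]
  · rw [← integral_radial_log_area hR hR1, intervalIntegral.integral_of_le hR]
    refine setIntegral_congr_fun measurableSet_Ioc fun ρ hρ => ?_
    dsimp only
    rw [integral_const_mul, ← integral_Ioc_eq_integral_Ioo,
      ← intervalIntegral.integral_of_le (by linarith [pi_pos]),
      integral_inv_one_add_mul_cos_mul_one_add_mul_sin hρ.1.le (hρ.2.trans_lt hR1)]
  · refine IntegrableOn.mono_set (t := Set.Icc 0 R ×ˢ Set.Icc (-π) π) ?_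
      (Set.prod_mono Set.Ioc_subset_Icc_self Set.Ioo_subset_Icc_self)
    refine ContinuousOn.integrableOn_compact (isCompact_Icc.prod isCompact_Icc) ?_
    refine continuousOn_fst.mul (continuousOn_const.div (by fun_prop) fun p hp => ?_)
    obtain ⟨h0, h1⟩ := hp.1
    have hu : 0 < 1 + p.1 * cos p.2 := by nlinarith [neg_one_le_cos p.2]
    have hv : 0 < 1 + p.1 * sin p.2 := by nlinarith [neg_one_le_sin p.2]
    exact (mul_pos hu hv).ne'

/-- The logarithmic area of the disk of radius `R < 1` centred at `(1, 1)`. -/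
lemma log_area_closedBall {R : ℝ} (hR : 0 ≤ R) (hR1 : R < 1) :
    ∫ p in Metric.closedBall (!₂[1, 1] : EuclideanSpace ℝ (Fin 2)) R, 1 / (p 0 * p 1)
      = π ^ 2 - 4 * π * arctan (√(1 - R ^ 2)) := by
  rw [← log_area_centered hR hR1]
  let e : EuclideanSpace ℝ (Fin 2) ≃ᵐ ℝ × ℝ :=
    (MeasurableEquiv.toLp 2 (Fin 2 → ℝ)).symm.trans MeasurableEquiv.finTwoArrow
  have he : MeasurePreserving e :=
    (volume_preserving_finTwoArrow ℝ).comp (PiLp.volume_preserving_ofLp (Fin 2))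
  have ht : MeasurePreserving (fun z : ℝ × ℝ => z + (-1, -1)) :=
    measurePreserving_add_right volume _
  have hm := (ht.comp he).setIntegral_preimage_emb
    ((MeasurableEquiv.addRight ((-1, -1) : ℝ × ℝ)).measurableEmbedding.comp e.measurableEmbedding)
    (fun z => 1 / ((1 + z.1) * (1 + z.2))) {z : ℝ × ℝ | z.1 ^ 2 + z.2 ^ 2 ≤ R ^ 2}
  rw [← hm]
  have hv (p : EuclideanSpace ℝ (Fin 2)) : e p = (p 0, p 1) := rfl
  have hset : Metric.closedBall (!₂[1, 1] : EuclideanSpace ℝ (Fin 2)) R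
      = ((fun z : ℝ × ℝ => z + (-1, -1)) ∘ e) ⁻¹' {z : ℝ × ℝ | z.1 ^ 2 + z.2 ^ 2 ≤ R ^ 2} := by
    ext p
    simp [EuclideanSpace.dist_eq, hv, Real.sqrt_le_left hR, Real.dist_eq, sq_abs,
      ← sub_eq_add_neg]
  rw [hset]
  simp [hv]

/-- For every `0 < c < π²` there is a closed disk of positive radius contained in the open
positive quadrant whose logarithmic area `∫_D 1/(x·y) dx dy` equals `c`. -/
theorem exists_disk_log_area_eq (c : ℝ) (hc : 0 < c) (hc' : c < π ^ 2) :
    ∃ (x : EuclideanSpace ℝ (Fin 2)) (r : ℝ), 0 < r ∧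
      Metric.closedBall x r ⊆ {p : EuclideanSpace ℝ (Fin 2) | 0 < p 0 ∧ 0 < p 1} ∧
      ∫ p in Metric.closedBall x r, 1 / (p 0 * p 1) = c := by
  have hπ := pi_pos
  set α := (π ^ 2 - c) / (4 * π) with hα
  have hα0 : 0 < α := by apply div_pos <;> linarith
  have hα1 : α < π / 4 := by
    rw [hα, div_lt_iff₀ (by positivity)]; nlinarith
  have ht0 : 0 < tan α := tan_pos_of_pos_of_lt_pi_div_two hα0 (by linarith)
  have ht1 : tan α < 1 := by
    rw [← tan_pi_div_four]
    exact tan_lt_tan_of_lt_of_lt_pi_div_two (by linarith) (by linarith) hα1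
  have hpos : 0 < 1 - tan α ^ 2 := by nlinarith
  have hr0 : 0 < √(1 - tan α ^ 2) := Real.sqrt_pos.2 hpos
  have hr1 : √(1 - tan α ^ 2) < 1 := by
    rw [Real.sqrt_lt' one_pos]; nlinarith
  refine ⟨!₂[1, 1], √(1 - tan α ^ 2), hr0, fun p hp => ?_, ?_⟩
  · have hcoord (i : Fin 2) : |p i - (!₂[1, 1] : EuclideanSpace ℝ (Fin 2)) i| < 1 := by
      have := PiLp.norm_apply_le (p - !₂[1, 1]) i
      rw [mem_closedBall_iff_norm] at hp
      exact (this.trans hp).trans_lt hr1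
    have h0 := (abs_lt.1 (hcoord 0)).1
    have h1 := (abs_lt.1 (hcoord 1)).1
    simp at h0 h1
    exact ⟨h0, h1⟩
  · rw [log_area_closedBall hr0.le hr1, Real.sq_sqrt hpos.le, sub_sub_cancel,
      Real.sqrt_sq ht0.le, arctan_tan (by linarith) (by linarith), hα]
    field_simp
    ring
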